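/- Let $\sigma^2 > 0$ and let $C_0$ be the vertical line $\{\mu_0 + i\eta : \eta \in \mathbb{R}\}$ in the complex plane with $\mu_0 = -1/\sigma^2$. Then for every complex $s$ with $\mathrm{Re}(s) \ge \mu_0/2$, one has $\frac{-1}{2\pi i} \int_{C_0} \frac{s}{z(s - z)} \log(1 + \tfrac{1}{2}\sigma^2 z)\, dz = -\log(1 + \tfrac{1}{2}\sigma^2 s)$, where $\log$ denotes the principal branch of the logarithm. -/

import Mathlib

open MeasureTheory

open Filter Topology

namespace Complex

theorem one_add_mul_re_pos {w : ℂ} (hw : -1 < w.re) {t : ℝ} (ht0 : 0 ≤ t) (ht1 : t ≤ 1) :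
    0 < (1 + t * w).re := by
  simp only [add_re, one_re, re_ofReal_mul]
  rcases ht0.eq_or_lt with rfl | ht
  · simp
  · nlinarith [mul_lt_mul_of_pos_left hw ht]

theorem integral_div_one_add_mul {w : ℂ} (hw : -1 < w.re) :
    ∫ t in (0 : ℝ)..1, w / (1 + t * w) = log (1 + w) := by
  have hpos : ∀ t ∈ Set.uIcc (0 : ℝ) 1, 0 < (1 + t * w).re := fun t ht => by
    rw [Set.uIcc_of_le zero_le_one] at ht
    exact one_add_mul_re_pos hw ht.1 ht.2
  have hderiv : ∀ t ∈ Set.uIcc (0 : ℝ) 1,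
      HasDerivAt (fun t : ℝ => log (1 + t * w)) (w / (1 + t * w)) t := fun t ht => by
    have h : HasDerivAt (fun t : ℝ => 1 + t * w) w t := by
      simpa using ((ofRealCLM.hasDerivAt (x := t)).mul_const w).const_add 1
    exact h.clog_real (Or.inl (hpos t ht))
  rw [intervalIntegral.integral_eq_sub_of_hasDerivAt hderiv]
  · simp
  · refine ContinuousOn.intervalIntegrable (ContinuousOn.div (by fun_prop) (by fun_prop) ?_)
    intro t ht h
    simpa [h] using hpos t ht

theorem tendsto_log_add_mul_sub_log (p : ℂ) {k : ℂ} (hk : k ∈ slitPlane) :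
    Tendsto (fun x : ℝ => log (p + x * k) - Real.log x) atTop (𝓝 (log k)) := by
  have h1 : Tendsto (fun x : ℝ => p * ((x⁻¹ : ℝ) : ℂ) + k) atTop (𝓝 k) := by
    have := ((continuous_ofReal.tendsto 0).comp tendsto_inv_atTop_zero).const_mul p
    simpa using this.add_const k
  refine (h1.clog hk).congr' ?_
  filter_upwards [eventually_gt_atTop 0,
    h1.eventually (isOpen_slitPlane.mem_nhds hk)] with x hx hx'
  have hx0 : (x : ℂ) ≠ 0 := by exact_mod_cast hx.ne'
  have : p + x * k = x * (p * ((x⁻¹ : ℝ) : ℂ) + k) := by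
    push_cast
    field_simp
  rw [this, log_ofReal_mul hx (slitPlane_ne_zero hx')]
  ring

theorem log_ofReal_mul_I {c : ℝ} (hc : 0 < c) : log (c * I) = Real.log c + Real.pi / 2 * I := by
  rw [log_ofReal_mul hc I_ne_zero, log_I]

theorem log_ofReal_mul_neg_I {c : ℝ} (hc : 0 < c) :
    log (c * -I) = Real.log c - Real.pi / 2 * I := by
  rw [log_ofReal_mul hc (neg_ne_zero.2 I_ne_zero), log_neg_I]
  ring

theorem tendsto_log_sub_log_atTop (p q : ℂ) {c : ℝ} (hc : 0 < c) :
    Tendsto (fun x : ℝ => log (p + x * (c * I)) - log (q + x * -I)) atTop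
      (𝓝 (Real.log c + Real.pi * I)) := by
  have h := (tendsto_log_add_mul_sub_log p (k := c * I) (by simp [mem_slitPlane_iff, hc.ne'])).sub
    (tendsto_log_add_mul_sub_log q (k := -I) (by simp [mem_slitPlane_iff]))
  rw [log_ofReal_mul_I hc, log_neg_I] at h
  convert h using 2
  · ring
  · ring

theorem tendsto_log_sub_log_atBot (p q : ℂ) {c : ℝ} (hc : 0 < c) :
    Tendsto (fun x : ℝ => log (p + x * (c * I)) - log (q + x * -I)) atBot
      (𝓝 (Real.log c - Real.pi * I)) := by
  have h := (tendsto_log_add_mul_sub_log p (k := c * -I) (by simp [mem_slitPlane_iff, hc.ne'])).sub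
    (tendsto_log_add_mul_sub_log q (k := I) (by simp [mem_slitPlane_iff]))
  rw [log_ofReal_mul_neg_I hc, log_I] at h
  have h' := h.comp tendsto_neg_atBot_atTop
  convert h' using 2
  · simp
  · ring

theorem norm_le_mul_of_norm_sub_le {u v : ℂ} {d K : ℝ} (hd : 0 < d) (hdv : d ≤ ‖v‖)
    (huv : ‖u - v‖ ≤ K) : ‖u‖ ≤ (1 + K / d) * ‖v‖ := by
  have hK : 0 ≤ K := (norm_nonneg _).trans huv
  have h1 : ‖u‖ ≤ ‖u - v‖ + ‖v‖ := by simpa using norm_add_le (u - v) v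
  have h2 : K ≤ K / d * ‖v‖ := by
    rw [div_mul_eq_mul_div, le_div_iff₀ hd]
    exact mul_le_mul_of_nonneg_left hdv hK
  linarith

theorem norm_one_add_ofReal_mul_I (x : ℝ) : ‖1 + x * I‖ = (1 + x ^ 2) ^ (1 / 2 : ℝ) := by
  rw [← Real.sqrt_eq_rpow, norm_def, normSq_apply]
  congr 1
  simp
  ring

section VerticalLine

variable {a m : ℝ} {s : ℂ}

theorem re_vertical (m x : ℝ) : (((-m : ℝ) : ℂ) + x * I).re = -m := by simp

theorem neg_one_lt_re_mul_vertical (ham : a * m < 1) (x : ℝ) :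
    -1 < (a * (((-m : ℝ) : ℂ) + x * I)).re := by
  rw [re_ofReal_mul, re_vertical]
  linarith

theorem le_norm_one_add_mul_vertical (ha : 0 < a) (hm : 0 < m) {t : ℝ} (ht : t ≤ 1)
    (x : ℝ) : 1 - a * m ≤ ‖1 + t * (a * (((-m : ℝ) : ℂ) + x * I))‖ := by
  refine le_trans ?_ (re_le_norm _)
  rw [add_re, re_ofReal_mul, re_ofReal_mul, re_vertical, one_re]
  nlinarith [mul_pos ha hm]

theorem re_sub_vertical (s : ℂ) (m x : ℝ) :
    (s - (((-m : ℝ) : ℂ) + x * I)).re = s.re + m := by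
  rw [sub_re, re_vertical]
  ring

theorem exists_mul_le_norm_mul_vertical (ha : 0 < a) (hm : 0 < m) (ham : a * m < 1)
    (hs : -m < s.re) : ∃ c : ℝ, 0 < c ∧ ∀ t : ℝ, 0 < t → t ≤ 1 → ∀ x : ℝ,
      c * (t ^ (1 / 2 : ℝ) * (1 + x ^ 2) ^ (3 / 4 : ℝ)) ≤
        ‖(s - (((-m : ℝ) : ℂ) + x * I)) * (1 + t * (a * (((-m : ℝ) : ℂ) + x * I)))‖ := by
  have he : 0 < 1 - a * m := by linarith
  have hd : 0 < s.re + m := by linarith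
  set A : ℝ := 1 + ‖1 + s + m‖ / (s.re + m)
  set B : ℝ := 1 + (1 + a * (1 + m)) / (1 - a * m)
  have hA0 : 0 < A := by positivity
  have hB0 : 0 < B := by positivity
  refine ⟨(A * (B / (a * (1 - a * m))) ^ (1 / 2 : ℝ))⁻¹, by positivity, fun t ht ht1 x => ?_⟩
  set z : ℂ := ((-m : ℝ) : ℂ) + x * I with hz
  have hN : 0 < 1 + x ^ 2 := by positivity
  have h1 : (1 + x ^ 2) ^ (1 / 2 : ℝ) ≤ A * ‖s - z‖ := by
    rw [← norm_one_add_ofReal_mul_I, ← norm_neg]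
    refine norm_le_mul_of_norm_sub_le hd ?_ ?_
    · exact (re_sub_vertical s m x).symm.le.trans (re_le_norm _)
    · rw [← norm_neg]
      refine le_of_eq (congrArg _ ?_)
      rw [hz]
      push_cast
      ring
  have hv := le_norm_one_add_mul_vertical ha hm ht1 x
  rw [← hz] at hv
  have h2 : t * a * (1 + x ^ 2) ^ (1 / 2 : ℝ) ≤ B * ‖1 + t * (a * z)‖ := by
    have : ‖((t * a : ℝ) : ℂ) * (1 + x * I)‖ = t * a * (1 + x ^ 2) ^ (1 / 2 : ℝ) := by
      rw [norm_mul, norm_one_add_ofReal_mul_I, norm_real, Real.norm_of_nonneg (by positivity)]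
    rw [← this]
    refine norm_le_mul_of_norm_sub_le he hv ?_
    have : ((t * a : ℝ) : ℂ) * (1 + x * I) - (1 + t * (a * z)) =
        ((t * (a * (1 + m)) - 1 : ℝ) : ℂ) := by
      rw [hz]
      push_cast
      ring
    rw [this, norm_real, Real.norm_eq_abs, abs_le]
    have : 0 < a * (1 + m) := by positivity
    constructor <;> nlinarith
  have h3 : t ^ (1 / 2 : ℝ) * (1 + x ^ 2) ^ (1 / 4 : ℝ) ≤
      (B / (a * (1 - a * m))) ^ (1 / 2 : ℝ) * ‖1 + t * (a * z)‖ := by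
    have h4 : t * (1 + x ^ 2) ^ (1 / 2 : ℝ) ≤
        B / (a * (1 - a * m)) * ‖1 + t * (a * z)‖ ^ 2 := by
      rw [div_mul_eq_mul_div, le_div_iff₀ (by positivity)]
      calc t * (1 + x ^ 2) ^ (1 / 2 : ℝ) * (a * (1 - a * m))
          = (t * a * (1 + x ^ 2) ^ (1 / 2 : ℝ)) * (1 - a * m) := by ring
        _ ≤ (B * ‖1 + t * (a * z)‖) * ‖1 + t * (a * z)‖ := by gcongr
        _ = _ := by ring
    have h5 := Real.rpow_le_rpow (by positivity) h4 (by norm_num : (0 : ℝ) ≤ 1 / 2)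
    rw [Real.mul_rpow ht.le (by positivity), Real.mul_rpow (by positivity) (by positivity),
      ← Real.rpow_mul hN.le, ← Real.sqrt_eq_rpow (‖_‖ ^ 2), Real.sqrt_sq (norm_nonneg _)] at h5
    norm_num at h5 ⊢
    exact h5
  rw [inv_mul_le_iff₀ (by positivity), norm_mul]
  calc t ^ (1 / 2 : ℝ) * (1 + x ^ 2) ^ (3 / 4 : ℝ)
      = (1 + x ^ 2) ^ (1 / 2 : ℝ) * (t ^ (1 / 2 : ℝ) * (1 + x ^ 2) ^ (1 / 4 : ℝ)) := by
        rw [mul_left_comm, ← Real.rpow_add hN]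
        norm_num
    _ ≤ (A * ‖s - z‖) * ((B / (a * (1 - a * m))) ^ (1 / 2 : ℝ) * ‖1 + t * (a * z)‖) := by
        gcongr
    _ = _ := by ring

theorem exists_norm_kernel_le (ha : 0 < a) (hm : 0 < m) (ham : a * m < 1)
    (hs : -m < s.re) : ∃ C : ℝ, ∀ t : ℝ, 0 < t → t ≤ 1 → ∀ x : ℝ,
      ‖s * a * I / ((s - (((-m : ℝ) : ℂ) + x * I)) * (1 + t * (a * (((-m : ℝ) : ℂ) + x * I))))‖ ≤
        C * ((1 + x ^ 2) ^ (-(3 / 4) : ℝ) * t ^ (-(1 / 2) : ℝ)) := by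
  obtain ⟨c, hc, h⟩ := exists_mul_le_norm_mul_vertical ha hm ham hs
  refine ⟨‖s * a * I‖ / c, fun t ht ht1 x => ?_⟩
  have hN : 0 < 1 + x ^ 2 := by positivity
  rw [norm_div, Real.rpow_neg hN.le, Real.rpow_neg ht.le, ← mul_inv, ← div_eq_mul_inv, div_div,
    mul_comm (_ ^ _) (t ^ _)]
  exact div_le_div_of_nonneg_left (norm_nonneg _) (by positivity) (h t ht ht1 x)

theorem integrable_one_add_sq_rpow :
    Integrable (fun x : ℝ => (1 + x ^ 2) ^ (-(3 / 4) : ℝ)) := by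
  have := integrable_rpow_neg_one_add_norm_sq (E := ℝ) (μ := volume) (r := 3 / 2) (by norm_num)
  refine this.congr (Eventually.of_forall fun x => ?_)
  norm_num

theorem measurable_kernel (s : ℂ) (a m : ℝ) : Measurable (fun p : ℝ × ℝ =>
    s * a * I / ((s - (((-m : ℝ) : ℂ) + p.1 * I)) *
      (1 + p.2 * (a * (((-m : ℝ) : ℂ) + p.1 * I))))) := by
  fun_prop

theorem integrable_kernel_prod (ha : 0 < a) (hm : 0 < m) (ham : a * m < 1) (hs : -m < s.re) :
    Integrable (fun p : ℝ × ℝ => s * a * I / ((s - (((-m : ℝ) : ℂ) + p.1 * I)) *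
      (1 + p.2 * (a * (((-m : ℝ) : ℂ) + p.1 * I)))))
      (volume.prod (volume.restrict (Set.Ioc 0 1))) := by
  obtain ⟨C, hC⟩ := exists_norm_kernel_le ha hm ham hs
  have ht : Integrable (fun t : ℝ => t ^ (-(1 / 2) : ℝ)) (volume.restrict (Set.Ioc 0 1)) :=
    (intervalIntegral.intervalIntegrable_rpow' (a := 0) (b := 1) (by norm_num)).1
  refine ((integrable_one_add_sq_rpow.mul_prod ht).const_mul C).mono'
    (measurable_kernel s a m).aestronglyMeasurable ?_
  have : (volume : Measure ℝ).prod (volume.restrict (Set.Ioc (0 : ℝ) 1)) =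
      (volume.prod volume).restrict (Set.univ ×ˢ Set.Ioc (0 : ℝ) 1) := by
    rw [← Measure.prod_restrict, Measure.restrict_univ]
  rw [this]
  filter_upwards [ae_restrict_mem (MeasurableSet.univ.prod measurableSet_Ioc)] with p hp
  exact hC p.2 hp.2.1 hp.2.2 p.1

theorem integrable_kernel (ha : 0 < a) (hm : 0 < m) (ham : a * m < 1) (hs : -m < s.re) {t : ℝ}
    (ht : 0 < t) (ht1 : t ≤ 1) :
    Integrable (fun x : ℝ => s * a * I / ((s - (((-m : ℝ) : ℂ) + x * I)) *
      (1 + t * (a * (((-m : ℝ) : ℂ) + x * I))))) := by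
  obtain ⟨C, hC⟩ := exists_norm_kernel_le ha hm ham hs
  refine ((integrable_one_add_sq_rpow.mul_const (t ^ (-(1 / 2) : ℝ))).const_mul C).mono'
    ((measurable_kernel s a m).comp (measurable_id.prodMk measurable_const)).aestronglyMeasurable
    (Eventually.of_forall (hC t ht ht1))

theorem neg_one_lt_re_mul (ha : 0 < a) (ham : a * m < 1) (hs : -m < s.re) :
    -1 < (a * s).re := by
  rw [re_ofReal_mul]
  nlinarith

theorem integral_kernel (ha : 0 < a) (hm : 0 < m) (ham : a * m < 1) (hs : -m < s.re) {t : ℝ}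
    (ht : 0 < t) (ht1 : t ≤ 1) :
    ∫ x : ℝ, s * a * I / ((s - (((-m : ℝ) : ℂ) + x * I)) *
      (1 + t * (a * (((-m : ℝ) : ℂ) + x * I)))) =
      2 * Real.pi * I * (a * s / (1 + t * (a * s))) := by
  have hta : 0 < t * a := mul_pos ht ha
  have h0 : 1 + t * (a * s) ≠ 0 := fun h => by
    simpa [h] using one_add_mul_re_pos (neg_one_lt_re_mul ha ham hs) ht.le ht1
  set G : ℝ → ℂ := fun x => log ((1 - t * a * m) + x * ((t * a : ℝ) * I)) -
    log ((s + m) + x * -I)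
  set D : ℂ := a * s / (1 + t * (a * s)) with hD
  have hderiv : ∀ x : ℝ, HasDerivAt (fun x => D * G x)
      (s * a * I / ((s - (((-m : ℝ) : ℂ) + x * I)) *
        (1 + t * (a * (((-m : ℝ) : ℂ) + x * I))))) x := fun x => by
    have e1 : (1 - t * a * m) + x * ((t * a : ℝ) * I) =
        1 + t * (a * (((-m : ℝ) : ℂ) + x * I)) := by
      push_cast
      ring
    have e2 : (s + m) + x * -I = s - (((-m : ℝ) : ℂ) + x * I) := by
      push_cast
      ring
    have p1 : 0 < (1 + t * (a * (((-m : ℝ) : ℂ) + x * I))).re :=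
      one_add_mul_re_pos (neg_one_lt_re_mul_vertical ham x) ht.le ht1
    have p2 : 0 < (s - (((-m : ℝ) : ℂ) + x * I)).re := by
      rw [re_sub_vertical]
      linarith
    have n1 : 1 + t * (a * (((-m : ℝ) : ℂ) + x * I)) ≠ 0 := fun h => by
      rw [h] at p1
      exact p1.false
    have n2 : s - (((-m : ℝ) : ℂ) + x * I) ≠ 0 := fun h => by
      rw [h] at p2
      exact p2.false
    have d (p k : ℂ) : HasDerivAt (fun x : ℝ => p + x * k) k x := by
      simpa using ((ofRealCLM.hasDerivAt (x := x)).mul_const k).const_add p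
    have g1 := (d (1 - t * a * m) ((t * a : ℝ) * I)).clog_real (Or.inl (by rwa [e1]))
    have g2 := (d (s + m) (-I)).clog_real (Or.inl (by rwa [e2]))
    refine ((g1.sub g2).const_mul D).congr_deriv ?_
    rw [e1, e2, hD]
    generalize hz : ((-m : ℝ) : ℂ) + x * I = z at n1 n2 ⊢
    push_cast
    rw [div_sub_div _ _ n1 n2, div_mul_div_comm,
      div_eq_div_iff (mul_ne_zero h0 (mul_ne_zero n1 n2)) (mul_ne_zero n2 n1)]
    ring
  rw [integral_of_hasDerivAt_of_tendsto hderiv (integrable_kernel ha hm ham hs ht ht1)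
    ((tendsto_log_sub_log_atBot _ _ hta).const_mul D)
    ((tendsto_log_sub_log_atTop _ _ hta).const_mul D)]
  ring

theorem integral_log_vertical (ha : 0 < a) (hm : 0 < m) (ham : a * m < 1) (hs : -m < s.re) :
    ∫ x : ℝ, s / ((((-m : ℝ) : ℂ) + x * I) * (s - (((-m : ℝ) : ℂ) + x * I))) *
      log (1 + a * (((-m : ℝ) : ℂ) + x * I)) * I = 2 * Real.pi * I * log (1 + a * s) := by
  have h1 (x : ℝ) : s / ((((-m : ℝ) : ℂ) + x * I) * (s - (((-m : ℝ) : ℂ) + x * I))) *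
      log (1 + a * (((-m : ℝ) : ℂ) + x * I)) * I =
      ∫ t in Set.Ioc (0 : ℝ) 1, s * a * I / ((s - (((-m : ℝ) : ℂ) + x * I)) *
        (1 + t * (a * (((-m : ℝ) : ℂ) + x * I)))) := by
    have hz0 : ((-m : ℝ) : ℂ) + x * I ≠ 0 := fun h => by
      have := re_vertical m x
      rw [h, zero_re] at this
      linarith
    rw [← integral_div_one_add_mul (neg_one_lt_re_mul_vertical ham x),
      intervalIntegral.integral_of_le zero_le_one, ← integral_const_mul, ← integral_mul_const]
    congr 1 with t
    generalize ((-m : ℝ) : ℂ) + x * I = z at hz0 ⊢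
    simp only [div_eq_mul_inv, mul_inv]
    field_simp
  simp_rw [h1]
  rw [integral_integral_swap (integrable_kernel_prod ha hm ham hs),
    setIntegral_congr_fun measurableSet_Ioc
      (fun t ht => integral_kernel ha hm ham hs ht.1 ht.2),
    integral_const_mul, ← intervalIntegral.integral_of_le zero_le_one,
    integral_div_one_add_mul (neg_one_lt_re_mul ha ham hs)]

end VerticalLine

end Complex

theorem stmt5 (σ2 : ℝ) (hσ : 0 < σ2) (s : ℂ) (hs : (-1/σ2)/2 ≤ s.re) :
    (-(2 * Real.pi * Complex.I)⁻¹) *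
      ∫ η : ℝ, (fun z : ℂ => s / (z * (s - z)) * Complex.log (1 + σ2/2 * z) * Complex.I)
        (((-1/σ2 : ℝ) : ℂ) + (η : ℂ) * Complex.I)
      = -Complex.log (1 + σ2/2 * s) := by
  have hm : 0 < 1 / σ2 := by positivity
  have h := Complex.integral_log_vertical (a := σ2 / 2) (m := 1 / σ2) (s := s) (by positivity) hm
    (by field_simp; norm_num) (by rw [neg_div] at hs; linarith)
  rw [← neg_div, Complex.ofReal_div σ2 2, Complex.ofReal_ofNat] at h
  beta_reduce
  rw [h, neg_mul, inv_mul_cancel_left₀ Complex.two_pi_I_ne_zero]
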